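/- Let K ⊆ ℝ^N be a closed convex pointed cone with nonempty interior and let U ⊆ K be a bounded set whose convex hull meets the interior of K. Define, for x ∈ K, |x|_U = inf{λ > 0 : x ∈ λ · coni(U)}. Then |·|_U is a valid norm on K: for every x ∈ K, |x|_U is finite; |x|_U = 0 if and only if x = 0; |c·x|_U = c·|x|_U for every c ≥ 0 and x ∈ K; and |x + y|_U ≤ |x|_U + |y|_U for all x, y ∈ K. -/

import Mathlib

open Matrix
open scoped Pointwise

/-- The conical convex hull of `U` with respect to the cone `K`:
`coni(U) = {x ∈ K : ∃ y ∈ conv(U), y - x ∈ K}`. -/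
def coniHull {N : ℕ} (K U : Set (Fin N → ℝ)) : Set (Fin N → ℝ) :=
  {x | x ∈ K ∧ ∃ y ∈ convexHull ℝ U, y - x ∈ K}

/-- `|x|_U = inf {l > 0 : x ∈ l • coni(U)}`. -/
noncomputable def coniNorm {N : ℕ} (K U : Set (Fin N → ℝ)) (x : Fin N → ℝ) : ℝ :=
  sInf {l : ℝ | 0 < l ∧ x ∈ l • coniHull K U}

/-- If `-x` is a limit of points of the form `l • y - x` with `l → 0` and `y` bounded, then `-x`
lies in any closed set containing these points. -/
theorem IsClosed.neg_mem_of_forall_smul_sub_mem {E : Type*} [NormedAddCommGroup E]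
    [NormedSpace ℝ E] {K V : Set E} (hK : IsClosed K) (hV : Bornology.IsBounded V) {x : E}
    (h : ∀ ε : ℝ, 0 < ε → ∃ l : ℝ, 0 < l ∧ l < ε ∧ ∃ y ∈ V, l • y - x ∈ K) : -x ∈ K := by
  obtain ⟨C, hC, hCV⟩ := hV.exists_pos_norm_le
  rw [← hK.closure_eq, Metric.mem_closure_iff]
  intro ε hε
  obtain ⟨l, hl, hlε, y, hy, hyK⟩ := h (ε / C) (div_pos hε hC)
  refine ⟨_, hyK, ?_⟩
  have hdist : dist (-x) (l • y - x) = l * ‖y‖ := by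
    rw [dist_eq_norm, show -x - (l • y - x) = -(l • y) by abel, norm_neg, norm_smul,
      Real.norm_of_nonneg hl.le]
  rw [hdist]
  calc l * ‖y‖ ≤ l * C := by gcongr; exact hCV y hy
    _ < ε := (lt_div_iff₀ hC).mp hlε

open Filter Topology in
theorem exists_pos_sub_smul_mem_of_mem_interior {E : Type*} [NormedAddCommGroup E]
    [NormedSpace ℝ E] {K : Set E} {y : E} (hy : y ∈ interior K) (x : E) :
    ∃ t : ℝ, 0 < t ∧ y - t • x ∈ K := by
  have hcont : Tendsto (fun t : ℝ => y - t • x) (𝓝[>] 0) (𝓝 y) := by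
    have h : Continuous fun t : ℝ => y - t • x := by fun_prop
    simpa using (h.tendsto 0).mono_left nhdsWithin_le_nhds
  obtain ⟨t, hK, ht⟩ :=
    ((hcont.eventually_mem (mem_interior_iff_mem_nhds.mp hy)).and self_mem_nhdsWithin).exists
  exact ⟨t, ht, hK⟩

section ConiHull

variable {N : ℕ} {K U : Set (Fin N → ℝ)}

theorem mem_smul_coniHull_iff (hKcone : ∀ c : ℝ, 0 ≤ c → ∀ x ∈ K, c • x ∈ K) {l : ℝ} (hl : 0 < l)
    {x : Fin N → ℝ} :
    x ∈ l • coniHull K U ↔ x ∈ K ∧ ∃ y ∈ convexHull ℝ U, l • y - x ∈ K := by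
  constructor
  · rintro ⟨z, ⟨hz, y, hy, hyz⟩, rfl⟩
    exact ⟨hKcone l hl.le z hz, y, hy, by simpa [smul_sub] using hKcone l hl.le _ hyz⟩
  · rintro ⟨hx, y, hy, hyx⟩
    have hl' : 0 ≤ l⁻¹ := inv_nonneg.mpr hl.le
    refine (Set.mem_smul_set_iff_inv_smul_mem₀ hl.ne' _ _).mpr ⟨hKcone _ hl' x hx, y, hy, ?_⟩
    simpa [smul_sub, smul_smul, inv_mul_cancel₀ hl.ne'] using hKcone _ hl' _ hyx

theorem add_mem_of_convex_of_smul_mem (hKconvex : Convex ℝ K)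
    (hKcone : ∀ c : ℝ, 0 ≤ c → ∀ x ∈ K, c • x ∈ K) {x y : Fin N → ℝ} (hx : x ∈ K) (hy : y ∈ K) :
    x + y ∈ K := by
  have h := hKcone 2 zero_le_two _
    (hKconvex hx hy (a := 1 / 2) (b := 1 / 2) (by norm_num) (by norm_num) (by norm_num))
  simpa [smul_add, smul_smul] using h

theorem add_mem_add_smul_coniHull (hKconvex : Convex ℝ K)
    (hKcone : ∀ c : ℝ, 0 ≤ c → ∀ x ∈ K, c • x ∈ K) {l m : ℝ} (hl : 0 < l) (hm : 0 < m)
    {x y : Fin N → ℝ} (hx : x ∈ l • coniHull K U) (hy : y ∈ m • coniHull K U) :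
    x + y ∈ (l + m) • coniHull K U := by
  rw [mem_smul_coniHull_iff hKcone hl] at hx
  rw [mem_smul_coniHull_iff hKcone hm] at hy
  obtain ⟨hx, u, hu, hux⟩ := hx
  obtain ⟨hy, v, hv, hvy⟩ := hy
  have hlm : 0 < l + m := add_pos hl hm
  refine (mem_smul_coniHull_iff hKcone hlm).mpr
    ⟨add_mem_of_convex_of_smul_mem hKconvex hKcone hx hy, (l / (l + m)) • u + (m / (l + m)) • v,
      convex_convexHull ℝ U hu hv (by positivity) (by positivity) (by field_simp), ?_⟩
  have h := add_mem_of_convex_of_smul_mem hKconvex hKcone hux hvy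
  rw [smul_add, smul_smul, smul_smul, mul_div_cancel₀ _ hlm.ne', mul_div_cancel₀ _ hlm.ne']
  convert h using 1
  abel

theorem bddBelow_setOf_mem_smul_coniHull (x : Fin N → ℝ) :
    BddBelow {l : ℝ | 0 < l ∧ x ∈ l • coniHull K U} :=
  ⟨0, fun _ h => h.1.le⟩

theorem nonempty_setOf_mem_smul_coniHull (hKcone : ∀ c : ℝ, 0 ≤ c → ∀ x ∈ K, c • x ∈ K)
    (hUint : (convexHull ℝ U ∩ interior K).Nonempty) {x : Fin N → ℝ} (hx : x ∈ K) :
    {l : ℝ | 0 < l ∧ x ∈ l • coniHull K U}.Nonempty := by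
  obtain ⟨y, hy, hyK⟩ := hUint
  obtain ⟨t, ht, htK⟩ := exists_pos_sub_smul_mem_of_mem_interior hyK x
  have ht' : 0 < t⁻¹ := inv_pos.mpr ht
  refine ⟨t⁻¹, ht', (mem_smul_coniHull_iff hKcone ht').mpr ⟨hx, y, hy, ?_⟩⟩
  simpa [smul_sub, smul_smul, inv_mul_cancel₀ ht.ne'] using hKcone _ ht'.le _ htK

theorem coniNorm_zero (hzero : (0 : Fin N → ℝ) ∈ coniHull K U) : coniNorm K U 0 = 0 := by
  have h : {l : ℝ | 0 < l ∧ (0 : Fin N → ℝ) ∈ l • coniHull K U} = Set.Ioi 0 := by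
    ext l
    exact ⟨fun h => h.1, fun hl => ⟨hl, 0, hzero, smul_zero l⟩⟩
  rw [coniNorm, h, csInf_Ioi]

theorem eq_zero_of_coniNorm_eq_zero (hKclosed : IsClosed K)
    (hKcone : ∀ c : ℝ, 0 ≤ c → ∀ x ∈ K, c • x ∈ K) (hKpointed : K ∩ (-K) ⊆ {0})
    (hUbd : Bornology.IsBounded U) (hUint : (convexHull ℝ U ∩ interior K).Nonempty)
    {x : Fin N → ℝ} (hx : x ∈ K) (h : coniNorm K U x = 0) : x = 0 := by
  refine hKpointed ⟨hx, hKclosed.neg_mem_of_forall_smul_sub_mem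
    (isBounded_convexHull.mpr hUbd) fun ε hε => ?_⟩
  obtain ⟨l, ⟨hl, hxl⟩, hlε⟩ := exists_lt_of_csInf_lt
    (nonempty_setOf_mem_smul_coniHull hKcone hUint hx) (h.trans_lt hε)
  exact ⟨l, hl, hlε, ((mem_smul_coniHull_iff hKcone hl).mp hxl).2⟩

theorem coniNorm_smul_of_pos {c : ℝ} (hc : 0 < c) (x : Fin N → ℝ) :
    coniNorm K U (c • x) = c * coniNorm K U x := by
  have h : {l : ℝ | 0 < l ∧ c • x ∈ l • coniHull K U} =
      c • {l : ℝ | 0 < l ∧ x ∈ l • coniHull K U} := by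
    ext l
    rw [Set.mem_smul_set_iff_inv_smul_mem₀ hc.ne', Set.mem_ofPred_eq, Set.mem_ofPred_eq,
      smul_eq_mul, mul_smul, Set.mem_smul_set_iff_inv_smul_mem₀ (inv_ne_zero hc.ne'), inv_inv]
    simp [hc]
  rw [coniNorm, h, Real.sInf_smul_of_nonneg hc.le, smul_eq_mul, coniNorm]

theorem coniNorm_add_le (hKconvex : Convex ℝ K) (hKcone : ∀ c : ℝ, 0 ≤ c → ∀ x ∈ K, c • x ∈ K)
    (hUint : (convexHull ℝ U ∩ interior K).Nonempty) {x y : Fin N → ℝ} (hx : x ∈ K) (hy : y ∈ K) :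
    coniNorm K U (x + y) ≤ coniNorm K U x + coniNorm K U y := by
  have hxne := nonempty_setOf_mem_smul_coniHull hKcone hUint hx
  have hyne := nonempty_setOf_mem_smul_coniHull hKcone hUint hy
  simp only [coniNorm]
  rw [← csInf_add hxne (bddBelow_setOf_mem_smul_coniHull x) hyne
    (bddBelow_setOf_mem_smul_coniHull y)]
  refine csInf_le_csInf (bddBelow_setOf_mem_smul_coniHull _) (hxne.add hyne) ?_
  rintro _ ⟨l, ⟨hl, hxl⟩, m, ⟨hm, hym⟩, rfl⟩
  exact ⟨add_pos hl hm, add_mem_add_smul_coniHull hKconvex hKcone hl hm hxl hym⟩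

end ConiHull

/-- if `K` is a closed convex pointed cone with nonempty interior
and `U ⊆ K` is bounded with `conv(U)` meeting the interior of `K`, then
`|·|_U` is a valid norm on `K`: it is finite on `K` (the defining set is
nonempty), vanishes exactly at `0`, is positively homogeneous, and satisfies
the triangle inequality. -/
theorem stmt2 {N : ℕ} (K U : Set (Fin N → ℝ))
    (hKclosed : IsClosed K) (hKconvex : Convex ℝ K)
    (hKcone : ∀ c : ℝ, 0 ≤ c → ∀ x ∈ K, c • x ∈ K)
    (hKpointed : K ∩ (-K) ⊆ {0})
    (hKint : (interior K).Nonempty)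
    (hUK : U ⊆ K)
    (hUbd : Bornology.IsBounded U)
    (hUint : (convexHull ℝ U ∩ interior K).Nonempty) :
    (∀ x ∈ K, {l : ℝ | 0 < l ∧ x ∈ l • coniHull K U}.Nonempty) ∧
    (∀ x ∈ K, (coniNorm K U x = 0 ↔ x = 0)) ∧
    (∀ c : ℝ, 0 ≤ c → ∀ x ∈ K, coniNorm K U (c • x) = c * coniNorm K U x) ∧
    (∀ x ∈ K, ∀ y ∈ K, coniNorm K U (x + y) ≤ coniNorm K U x + coniNorm K U y) := by
  have hzero : (0 : Fin N → ℝ) ∈ coniHull K U := by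
    obtain ⟨y, hy, -⟩ := hUint
    have hyK := convexHull_min hUK hKconvex hy
    exact ⟨by simpa using hKcone 0 le_rfl y hyK, y, hy, by simpa using hyK⟩
  refine ⟨fun x hx => nonempty_setOf_mem_smul_coniHull hKcone hUint hx, fun x hx =>
    ⟨eq_zero_of_coniNorm_eq_zero hKclosed hKcone hKpointed hUbd hUint hx, ?_⟩, ?_,
    fun x hx y hy => coniNorm_add_le hKconvex hKcone hUint hx hy⟩
  · rintro rfl
    exact coniNorm_zero hzero
  · intro c hc x _
    rcases hc.eq_or_lt with rfl | hc
    · rw [zero_smul, zero_mul, coniNorm_zero hzero]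
    · exact coniNorm_smul_of_pos hc x
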